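/- The function ψ is strictly increasing on (0, Υ(b∣C)): for all λ1, λ2 with 0 < λ1 < λ2 < Υ(b∣C), one has ‖Π_{λ1C}(b)‖ < ‖Π_{λ2C}(b)‖. -/

import Mathlib

open Pointwise RealInnerProductSpace

/-- The gauge `Υ(b ∣ C) := inf {λ ≥ 0 : b ∈ λ • C}`. -/
noncomputable def gaugeAt {p : ℕ} (C : Set (EuclideanSpace ℝ (Fin p)))
    (b : EuclideanSpace ℝ (Fin p)) : ℝ :=
  sInf {r : ℝ | 0 ≤ r ∧ b ∈ r • C}

theorem inner_sub_le_zero_of_forall_norm_sub_le {E : Type*} [NormedAddCommGroup E]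
    [InnerProductSpace ℝ E] {K : Set E} (hK : Convex ℝ K) {b x : E} (hx : x ∈ K)
    (hmin : ∀ w ∈ K, ‖b - x‖ ≤ ‖b - w‖) : ∀ w ∈ K, ⟪b - x, w - x⟫ ≤ 0 := by
  refine (norm_eq_iInf_iff_real_inner_le_zero hK hx).1 (le_antisymm ?_ ?_)
  · have : Nonempty K := ⟨⟨x, hx⟩⟩
    exact le_ciInf fun w => hmin w w.2
  · exact ciInf_le (f := fun w : K => ‖b - w‖) ⟨0, by rintro _ ⟨w, rfl⟩; exact norm_nonneg _⟩ ⟨x, hx⟩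

/-- The function `ψ(λ) = ‖Π_{λC}(b)‖` is strictly increasing on `(0, Υ(b∣C))`. -/
theorem psi_strict_mono {p : ℕ} (hp : 0 < p)
    (C : Set (EuclideanSpace ℝ (Fin p))) (b : EuclideanSpace ℝ (Fin p))
    (hCclosed : IsClosed C) (hCconv : Convex ℝ C)
    (h0C : (0 : EuclideanSpace ℝ (Fin p)) ∈ C)
    (hfin : {r : ℝ | 0 ≤ r ∧ b ∈ r • C}.Nonempty)
    (hpos : 0 < gaugeAt C b)
    (P : ℝ → EuclideanSpace ℝ (Fin p))
    (hP : ∀ l : ℝ, 0 < l → P l ∈ l • C ∧ ∀ w ∈ l • C, ‖b - P l‖ ≤ ‖b - w‖) :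
    ∀ l1 l2 : ℝ, 0 < l1 → l1 < l2 → l2 < gaugeAt C b → ‖P l1‖ < ‖P l2‖ := by
  intro l1 l2 h1 h12 h2
  have hl2 : 0 < l2 := h1.trans h12
  have var1 := inner_sub_le_zero_of_forall_norm_sub_le (hCconv.smul l1) (hP l1 h1).1 (hP l1 h1).2
  have var2 := inner_sub_le_zero_of_forall_norm_sub_le (hCconv.smul l2) (hP l2 hl2).1 (hP l2 hl2).2
  obtain ⟨c1, hc1, e1⟩ := (hP l1 h1).1
  obtain ⟨c2, hc2, e2⟩ := (hP l2 hl2).1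
  have hA := var1 (l1 • c2) (Set.smul_mem_smul_set hc2)
  have hB := var2 (l2 • c1) (Set.smul_mem_smul_set hc1)
  have hmem := (hP l1 h1).1
  simp only at e1 e2
  rw [← e1] at hA hmem var1
  rw [← e2] at hB
  rw [← e1, ← e2]
  have hsum : l1 * ‖l2 • c2‖ ^ 2 + l2 * ‖l1 • c1‖ ^ 2 ≤ (l1 + l2) * ⟪l1 • c1, l2 • c2⟫ := by
    rw [← real_inner_self_eq_norm_sq, ← real_inner_self_eq_norm_sq]
    simp only [inner_sub_left, inner_sub_right, real_inner_smul_left, real_inner_smul_right,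
      real_inner_comm c2 c1] at hA hB ⊢
    nlinarith [mul_le_mul_of_nonneg_left hA hl2.le, mul_le_mul_of_nonneg_left hB h1.le]
  have hcs := real_inner_le_norm (l1 • c1) (l2 • c2)
  have hn1 := norm_nonneg (l1 • c1)
  have hn2 := norm_nonneg (l2 • c2)
  have hfactor : (‖l2 • c2‖ - ‖l1 • c1‖) * (l1 * ‖l2 • c2‖ - l2 * ‖l1 • c1‖) ≤ 0 := by
    nlinarith [mul_le_mul_of_nonneg_left hcs (add_pos h1 hl2).le]
  by_contra! hle
  have heq : ‖l2 • c2‖ = ‖l1 • c1‖ := by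
    refine hle.antisymm (not_lt.1 fun hlt => ?_)
    have : l1 * ‖l2 • c2‖ < l2 * ‖l1 • c1‖ := by nlinarith
    nlinarith [mul_pos (sub_pos.2 hlt) (sub_pos.2 this)]
  have hvec : l1 • c1 = l2 • c2 := by
    rw [← sub_eq_zero, ← norm_eq_zero, ← sq_eq_zero_iff]
    refine le_antisymm ?_ (sq_nonneg _)
    rw [norm_sub_sq_real]
    rw [heq] at hsum ⊢
    have : ‖l1 • c1‖ ^ 2 ≤ ⟪l1 • c1, l2 • c2⟫ :=
      le_of_mul_le_mul_left (by linarith) (add_pos h1 hl2)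
    linarith
  rw [← hvec] at hB
  have hc1_nonpos : ⟪b - l1 • c1, c1⟫ ≤ 0 := by
    rw [← sub_smul, real_inner_smul_right] at hB
    exact nonpos_of_mul_nonpos_right hB (sub_pos.2 h12)
  have hc1_nonneg : 0 ≤ ⟪b - l1 • c1, c1⟫ := by
    have := var1 0 ⟨0, h0C, smul_zero _⟩
    rw [zero_sub, inner_neg_right, real_inner_smul_right] at this
    exact nonneg_of_mul_nonneg_right (by linarith) h1
  have horth : ⟪b - l1 • c1, l1 • c1⟫ = 0 := by
    rw [real_inner_smul_right, hc1_nonpos.antisymm hc1_nonneg, mul_zero]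
  obtain ⟨r, hr, c, hc, hbc⟩ := hfin
  simp only at hbc
  have hc0 : ⟪b - l1 • c1, c⟫ ≤ 0 := by
    have := var1 (l1 • c) (Set.smul_mem_smul_set hc)
    rw [inner_sub_right, real_inner_smul_right] at this
    exact nonpos_of_mul_nonpos_right (by linarith) h1
  have hb : b = l1 • c1 := by
    refine sub_eq_zero.1 ((inner_self_eq_zero (𝕜 := ℝ)).1
      (le_antisymm ?_ real_inner_self_nonneg))
    have : ⟪b - l1 • c1, b⟫ = r * ⟪b - l1 • c1, c⟫ := by
      rw [← real_inner_smul_right, hbc]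
    rw [inner_sub_right, horth, sub_zero, this]
    exact mul_nonpos_of_nonneg_of_nonpos hr hc0
  have hg : gaugeAt C b ≤ l1 := csInf_le ⟨0, fun _ h => h.1⟩ ⟨h1.le, hb ▸ hmem⟩
  linarith
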